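/- Let α ∈ ℝ with α ≠ 2. The infimum, over all functions u : ℝ² → ℝ of class C² with compact support contained in ℝ² \ {0} and with ∫_{ℝ²} |x|^{α-2} |∇u(x)|² dx ≠ 0, of the quotient (∫_{ℝ²} |x|^α |Δu(x)|² dx) / (∫_{ℝ²} |x|^{α-2} |∇u(x)|² dx) equals the infimum over integers k ≥ 0 of (k² - (α-2)²/4)² / (k² + (α-2)²/4). -/

import Mathlib

open MeasureTheory

noncomputable def lap {n : ℕ} (u : EuclideanSpace ℝ (Fin n) → ℝ)
    (x : EuclideanSpace ℝ (Fin n)) : ℝ :=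
  ∑ i : Fin n, iteratedFDeriv ℝ 2 u x ![EuclideanSpace.single i 1, EuclideanSpace.single i 1]

theorem hasDerivAt_integral_of_continuous {F F' : ℝ → ℝ → ℝ} (a b : ℝ)
    (hF : Continuous (Function.uncurry F)) (hF' : Continuous (Function.uncurry F'))
    (hd : ∀ t s, HasDerivAt (fun t => F t s) (F' t s) t) (t : ℝ) :
    HasDerivAt (fun t => ∫ s in a..b, F t s) (∫ s in a..b, F' t s) t := by
  have hF1 : ∀ t, Continuous (F t) := fun t => hF.comp (by fun_prop : Continuous fun s => (t, s))
  have hF2 : ∀ t, Continuous (F' t) := fun t => hF'.comp (by fun_prop : Continuous fun s => (t, s))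
  obtain ⟨C, hC⟩ := ((isCompact_closedBall t 1).prod
    (isCompact_uIcc (a := a) (b := b))).exists_bound_of_continuousOn hF'.continuousOn
  refine (intervalIntegral.hasDerivAt_integral_of_dominated_loc_of_deriv_le
    (F := F) (F' := F') (bound := fun _ => C) (Metric.ball_mem_nhds t one_pos) ?_ ?_ ?_ ?_ ?_ ?_).2
  · exact Filter.Eventually.of_forall fun x => (hF1 x).aestronglyMeasurable
  · exact (hF1 t).intervalIntegrable _ _
  · exact (hF2 t).aestronglyMeasurable
  · exact Filter.Eventually.of_forall fun s hs x hx =>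
      hC (x, s) ⟨Metric.ball_subset_closedBall hx, Set.uIoc_subset_uIcc hs⟩
  · simp
  · exact Filter.Eventually.of_forall fun s _ x _ => hd x s

theorem hasSum_intervalIntegral_of_nonneg {F : ℤ → ℝ → ℝ} {G : ℝ → ℝ} {a b : ℝ} (hab : a ≤ b)
    (hF : ∀ k, Continuous (F k)) (hG : Continuous G) (h0 : ∀ k t, 0 ≤ F k t)
    (hs : ∀ t, HasSum (fun k => F k t) (G t)) :
    HasSum (fun k => ∫ t in a..b, F k t) (∫ t in a..b, G t) := by
  have hsum : Summable fun k => ∫ t in a..b, F k t := by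
    refine summable_of_sum_le (c := ∫ t in a..b, G t)
      (fun k => intervalIntegral.integral_nonneg hab fun t _ => h0 k t) fun s => ?_
    rw [← intervalIntegral.integral_finsetSum fun k _ => (hF k).intervalIntegrable _ _]
    exact intervalIntegral.integral_mono_on hab
      ((continuous_finsetSum s fun k _ => hF k).intervalIntegrable _ _)
      (hG.intervalIntegrable _ _) fun t _ => sum_le_hasSum s (fun k _ => h0 k t) (hs t)
  simp only [intervalIntegral.integral_of_le hab] at hsum ⊢
  have h := hasSum_integral_of_summable_integral_norm (μ := volume.restrict (Set.Ioc a b)) (F := F)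
    (fun k => ((hF k).intervalIntegrable a b).1)
    (by simpa only [Real.norm_of_nonneg (h0 _ _)] using hsum)
  simpa only [(hs _).tsum_eq] using h

/-- The unnormalised cosine Fourier coefficient on `[-π, π]`. -/
noncomputable def cosCoeff (k : ℤ) (g : ℝ → ℝ) : ℝ :=
  ∫ θ in (-Real.pi)..Real.pi, Real.cos (k * θ) * g θ

/-- The unnormalised sine Fourier coefficient on `[-π, π]`. -/
noncomputable def sinCoeff (k : ℤ) (g : ℝ → ℝ) : ℝ :=
  ∫ θ in (-Real.pi)..Real.pi, Real.sin (k * θ) * g θ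

theorem hasSum_cosCoeff_sq_add_sinCoeff_sq {g : ℝ → ℝ} (hg : Continuous g) :
    HasSum (fun k => cosCoeff k g ^ 2 + sinCoeff k g ^ 2)
      (2 * Real.pi * ∫ θ in (-Real.pi)..Real.pi, g θ ^ 2) := by
  have hπ : -Real.pi < Real.pi := by linarith [Real.pi_pos]
  have hmem : MemLp (fun θ => (g θ : ℂ)) 2 (volume.restrict (Set.Ioc (-Real.pi) Real.pi)) := by
    obtain ⟨C, hC⟩ := (isCompact_Icc (a := -Real.pi) (b := Real.pi)).exists_bound_of_continuousOn
      hg.continuousOn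
    refine MemLp.of_bound (by fun_prop) C ?_
    filter_upwards [ae_restrict_mem measurableSet_Ioc] with θ hθ
    simpa using hC θ (Set.Ioc_subset_Icc_self hθ)
  have h := (hasSum_sq_fourierCoeffOn hπ hmem).mul_left ((2 * Real.pi) ^ 2)
  have hcoeff : ∀ k : ℤ, fourierCoeffOn hπ (fun θ => (g θ : ℂ)) k =
      (1 / (2 * Real.pi) : ℝ) • ((cosCoeff k g : ℂ) - sinCoeff k g * Complex.I) := by
    intro k
    rw [fourierCoeffOn_eq_integral]
    congr 1
    · congr 1; ring
    · have e : ∀ θ : ℝ, fourier (-k) (θ : AddCircle (Real.pi - -Real.pi)) • (g θ : ℂ) =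
          ((Real.cos (k * θ) * g θ : ℝ) : ℂ) - ((Real.sin (k * θ) * g θ : ℝ) : ℂ) * Complex.I := by
        intro θ
        rw [fourier_coe_apply]
        have : 2 * (Real.pi : ℂ) * Complex.I * ((-k : ℤ) : ℂ) * θ / ((Real.pi - -Real.pi : ℝ) : ℂ)
            = ((-(k * θ) : ℝ) : ℂ) * Complex.I := by
          have : (Real.pi : ℂ) ≠ 0 := by exact_mod_cast Real.pi_ne_zero
          push_cast
          field_simp
          ring
        rw [this, Complex.exp_mul_I, ← Complex.ofReal_cos, ← Complex.ofReal_sin, Real.cos_neg,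
          Real.sin_neg, smul_eq_mul]
        push_cast
        ring
      simp_rw [e]
      rw [intervalIntegral.integral_sub, intervalIntegral.integral_mul_const,
        intervalIntegral.integral_ofReal, intervalIntegral.integral_ofReal]
      · rfl
      · exact Continuous.intervalIntegrable (by fun_prop) _ _
      · exact Continuous.intervalIntegrable (by fun_prop) _ _
  have hn : ∀ x y : ℝ, ‖(x : ℂ) - y * Complex.I‖ ^ 2 = x ^ 2 + y ^ 2 := by
    intro x y
    rw [← Complex.normSq_eq_norm_sq, Complex.normSq_apply]
    simp
    ring
  have hterm : ∀ k : ℤ, (2 * Real.pi) ^ 2 * ‖fourierCoeffOn hπ (fun θ => (g θ : ℂ)) k‖ ^ 2 =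
      cosCoeff k g ^ 2 + sinCoeff k g ^ 2 := by
    intro k
    rw [hcoeff, norm_smul, mul_pow ‖(1 / (2 * Real.pi) : ℝ)‖, hn, Real.norm_eq_abs, sq_abs]
    field_simp
  have htotal : (2 * Real.pi) ^ 2 * (Real.pi - -Real.pi)⁻¹ •
      ∫ θ in (-Real.pi)..Real.pi, ‖(g θ : ℂ)‖ ^ 2 =
      2 * Real.pi * ∫ θ in (-Real.pi)..Real.pi, g θ ^ 2 := by
    simp only [Complex.norm_real, Real.norm_eq_abs, sq_abs, smul_eq_mul]
    rw [sub_neg_eq_add]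
    field_simp
    ring
  rw [← htotal]
  simpa only [hterm] using h

theorem cosCoeff_deriv {g g' : ℝ → ℝ} (hg : ∀ θ, HasDerivAt g (g' θ) θ) (hg' : Continuous g')
    (hper : g Real.pi = g (-Real.pi)) (k : ℤ) : cosCoeff k g' = k * sinCoeff k g := by
  have hgc : Continuous g := continuous_iff_continuousAt.2 fun θ => (hg θ).continuousAt
  have h := intervalIntegral.integral_mul_deriv_eq_deriv_mul (a := -Real.pi) (b := Real.pi)
    (u := fun θ => Real.cos (k * θ)) (u' := fun θ => -Real.sin (k * θ) * (k * 1)) (v := g)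
    (fun θ _ => (Real.hasDerivAt_cos _).comp θ ((hasDerivAt_id θ).const_mul (k : ℝ)))
    (fun θ _ => hg θ) (Continuous.intervalIntegrable (by fun_prop) _ _)
    (hg'.intervalIntegrable _ _)
  rw [cosCoeff, h, sinCoeff, ← intervalIntegral.integral_const_mul, hper, mul_neg, Real.cos_neg,
    sub_self, zero_sub, ← intervalIntegral.integral_neg]
  congr 1; ext θ; ring

theorem sinCoeff_deriv {g g' : ℝ → ℝ} (hg : ∀ θ, HasDerivAt g (g' θ) θ) (hg' : Continuous g')
    (k : ℤ) : sinCoeff k g' = -(k * cosCoeff k g) := by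
  have hgc : Continuous g := continuous_iff_continuousAt.2 fun θ => (hg θ).continuousAt
  have h := intervalIntegral.integral_mul_deriv_eq_deriv_mul (a := -Real.pi) (b := Real.pi)
    (u := fun θ => Real.sin (k * θ)) (u' := fun θ => Real.cos (k * θ) * (k * 1)) (v := g)
    (fun θ _ => (Real.hasDerivAt_sin _).comp θ ((hasDerivAt_id θ).const_mul (k : ℝ)))
    (fun θ _ => hg θ) (Continuous.intervalIntegrable (by fun_prop) _ _)
    (hg'.intervalIntegrable _ _)
  rw [sinCoeff, h, cosCoeff, ← intervalIntegral.integral_const_mul, mul_neg, Real.sin_neg,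
    Real.sin_int_mul_pi, ← intervalIntegral.integral_neg]
  simp only [neg_zero, zero_mul, sub_self, zero_sub, ← intervalIntegral.integral_neg]
  congr 1; ext θ; ring

/-- The one-dimensional weighted inequality satisfied by each angular mode. -/
theorem mode_inequality {g g₁ g₂ : ℝ → ℝ} (h₁ : ∀ t, HasDerivAt g (g₁ t) t)
    (h₂ : ∀ t, HasDerivAt g₁ (g₂ t) t) (hc : Continuous g₂) {T a q δ : ℝ} (hT : -T ≤ T)
    (hg : g T = 0 ∧ g (-T) = 0) (hg₁ : g₁ T = 0 ∧ g₁ (-T) = 0) (hq : 0 ≤ q) (hm : 0 < q + a ^ 2)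
    (hδ : δ * (q + a ^ 2) ≤ (q - a ^ 2) ^ 2) :
    δ * ∫ t in (-T)..T, Real.exp (-2 * a * t) * (g₁ t ^ 2 + q * g t ^ 2) ≤
      ∫ t in (-T)..T, Real.exp (-2 * a * t) * (g₂ t - q * g t) ^ 2 := by
  have hgc : Continuous g := continuous_iff_continuousAt.2 fun t => (h₁ t).continuousAt
  have hg₁c : Continuous g₁ := continuous_iff_continuousAt.2 fun t => (h₂ t).continuousAt
  have hδm : δ ≤ q + a ^ 2 := by
    by_contra! h
    nlinarith [mul_pos (sub_pos.2 h) hm, mul_nonneg hq (sq_nonneg a)]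
  -- `B` is the total derivative produced by integrating the cross terms by parts
  let B : ℝ → ℝ := fun t => Real.exp (-2 * a * t) *
    (2 * a * (g₁ t - a * g t) ^ 2 - 2 * a * (q - a ^ 2) * g t ^ 2
      - 2 * (q - a ^ 2) * (g t * (g₁ t - a * g t)) - δ * a * g t ^ 2)
  let B' : ℝ → ℝ := fun t => Real.exp (-2 * a * t) * ((g₂ t - q * g t) ^ 2
      - δ * (g₁ t ^ 2 + q * g t ^ 2)
      - ((g₂ t - 2 * a * g₁ t + a ^ 2 * g t) ^ 2
        + (2 * (q + a ^ 2) - δ) * (g₁ t - a * g t) ^ 2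
        + ((q - a ^ 2) ^ 2 - δ * (q + a ^ 2)) * g t ^ 2))
  have hB : ∀ t, HasDerivAt B (B' t) t := by
    intro t
    have he : HasDerivAt (fun t => Real.exp (-2 * a * t)) (Real.exp (-2 * a * t) * (-2 * a * 1)) t :=
      ((hasDerivAt_id t).const_mul (-2 * a)).exp
    have hf := (h₂ t).sub ((h₁ t).const_mul a)
    convert! he.mul ((((hf.pow 2).const_mul (2 * a)).sub
      (((h₁ t).pow 2).const_mul (2 * a * (q - a ^ 2)))).sub
      (((h₁ t).mul hf).const_mul (2 * (q - a ^ 2))) |>.sub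
      (((h₁ t).pow 2).const_mul (δ * a))) using 1
    simp only [B', Pi.sub_apply, Pi.mul_apply, Pi.pow_apply]
    push_cast
    ring
  have hB'c : Continuous B' := by simp only [B']; fun_prop
  have hint : ∫ t in (-T)..T, B' t = 0 := by
    rw [intervalIntegral.integral_eq_sub_of_hasDerivAt (fun t _ => hB t)
      (hB'c.intervalIntegrable _ _)]
    simp [B, hg, hg₁]
  rw [← sub_nonneg, ← intervalIntegral.integral_const_mul, ← intervalIntegral.integral_sub
    (Continuous.intervalIntegrable (by fun_prop) _ _)
    (Continuous.intervalIntegrable (by fun_prop) _ _)]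
  refine hint.symm.le.trans (intervalIntegral.integral_mono_on hT (hB'c.intervalIntegrable _ _)
    (Continuous.intervalIntegrable (by fun_prop) _ _) fun t _ => ?_)
  have h3 : 0 ≤ Real.exp (-2 * a * t) * ((g₂ t - 2 * a * g₁ t + a ^ 2 * g t) ^ 2
        + (2 * (q + a ^ 2) - δ) * (g₁ t - a * g t) ^ 2
        + ((q - a ^ 2) ^ 2 - δ * (q + a ^ 2)) * g t ^ 2) := by
    have : 0 ≤ 2 * (q + a ^ 2) - δ := by linarith
    have : 0 ≤ (q - a ^ 2) ^ 2 - δ * (q + a ^ 2) := by linarith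
    positivity
  simp only [B']
  linarith

theorem cosCoeff_hasDerivAt {F F' : ℝ → ℝ → ℝ} (hF : Continuous (Function.uncurry F))
    (hF' : Continuous (Function.uncurry F')) (hd : ∀ t s, HasDerivAt (fun t => F t s) (F' t s) t)
    (k : ℤ) (t : ℝ) :
    HasDerivAt (fun t => cosCoeff k (F t)) (cosCoeff k (F' t)) t :=
  hasDerivAt_integral_of_continuous (F := fun t θ => Real.cos (k * θ) * F t θ)
    (F' := fun t θ => Real.cos (k * θ) * F' t θ) _ _
    ((by fun_prop : Continuous fun p : ℝ × ℝ => Real.cos (k * p.2)).mul hF)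
    ((by fun_prop : Continuous fun p : ℝ × ℝ => Real.cos (k * p.2)).mul hF')
    (fun t s => (hd t s).const_mul _) t

theorem sinCoeff_hasDerivAt {F F' : ℝ → ℝ → ℝ} (hF : Continuous (Function.uncurry F))
    (hF' : Continuous (Function.uncurry F')) (hd : ∀ t s, HasDerivAt (fun t => F t s) (F' t s) t)
    (k : ℤ) (t : ℝ) :
    HasDerivAt (fun t => sinCoeff k (F t)) (sinCoeff k (F' t)) t :=
  hasDerivAt_integral_of_continuous (F := fun t θ => Real.sin (k * θ) * F t θ)
    (F' := fun t θ => Real.sin (k * θ) * F' t θ) _ _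
    ((by fun_prop : Continuous fun p : ℝ × ℝ => Real.sin (k * p.2)).mul hF)
    ((by fun_prop : Continuous fun p : ℝ × ℝ => Real.sin (k * p.2)).mul hF')
    (fun t s => (hd t s).const_mul _) t

theorem continuous_cosCoeff {F : ℝ → ℝ → ℝ} (hF : Continuous (Function.uncurry F)) (k : ℤ) :
    Continuous fun t => cosCoeff k (F t) :=
  intervalIntegral.continuous_parametric_intervalIntegral_of_continuous'
    (f := fun t θ => Real.cos (k * θ) * F t θ)
    ((by fun_prop : Continuous fun p : ℝ × ℝ => Real.cos (k * p.2)).mul hF) _ _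

theorem continuous_sinCoeff {F : ℝ → ℝ → ℝ} (hF : Continuous (Function.uncurry F)) (k : ℤ) :
    Continuous fun t => sinCoeff k (F t) :=
  intervalIntegral.continuous_parametric_intervalIntegral_of_continuous'
    (f := fun t θ => Real.sin (k * θ) * F t θ)
    ((by fun_prop : Continuous fun p : ℝ × ℝ => Real.sin (k * p.2)).mul hF) _ _

theorem cosCoeff_add {f g : ℝ → ℝ} (hf : Continuous f) (hg : Continuous g) (k : ℤ) :
    cosCoeff k (fun θ => f θ + g θ) = cosCoeff k f + cosCoeff k g := by
  simp only [cosCoeff, mul_add]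
  exact intervalIntegral.integral_add (Continuous.intervalIntegrable (by fun_prop) _ _)
    (Continuous.intervalIntegrable (by fun_prop) _ _)

theorem sinCoeff_add {f g : ℝ → ℝ} (hf : Continuous f) (hg : Continuous g) (k : ℤ) :
    sinCoeff k (fun θ => f θ + g θ) = sinCoeff k f + sinCoeff k g := by
  simp only [sinCoeff, mul_add]
  exact intervalIntegral.integral_add (Continuous.intervalIntegrable (by fun_prop) _ _)
    (Continuous.intervalIntegrable (by fun_prop) _ _)

/-- The weighted inequality on the cylinder, obtained by summing `mode_inequality` over all
angular modes. -/
theorem cylinder_inequality {v v₁ v₂ w₁ w₂ : ℝ → ℝ → ℝ} (hv : Continuous (Function.uncurry v))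
    (hv₁ : Continuous (Function.uncurry v₁)) (hv₂ : Continuous (Function.uncurry v₂))
    (hw₁ : Continuous (Function.uncurry w₁)) (hw₂ : Continuous (Function.uncurry w₂))
    (dv : ∀ t θ, HasDerivAt (fun t => v t θ) (v₁ t θ) t)
    (dv₁ : ∀ t θ, HasDerivAt (fun t => v₁ t θ) (v₂ t θ) t)
    (dw : ∀ t θ, HasDerivAt (fun θ => v t θ) (w₁ t θ) θ)
    (dw₁ : ∀ t θ, HasDerivAt (fun θ => w₁ t θ) (w₂ t θ) θ)
    (pv : ∀ t, v t Real.pi = v t (-Real.pi)) (pw : ∀ t, w₁ t Real.pi = w₁ t (-Real.pi))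
    {T a δ : ℝ} (hT : -T ≤ T) (zv : ∀ θ, v T θ = 0 ∧ v (-T) θ = 0)
    (zv₁ : ∀ θ, v₁ T θ = 0 ∧ v₁ (-T) θ = 0) (ha : a ≠ 0)
    (hδ : ∀ k : ℤ, δ * ((k : ℝ) ^ 2 + a ^ 2) ≤ ((k : ℝ) ^ 2 - a ^ 2) ^ 2) :
    δ * ∫ t in (-T)..T, ∫ θ in (-Real.pi)..Real.pi,
        Real.exp (-2 * a * t) * (v₁ t θ ^ 2 + w₁ t θ ^ 2) ≤
      ∫ t in (-T)..T, ∫ θ in (-Real.pi)..Real.pi,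
        Real.exp (-2 * a * t) * (v₂ t θ + w₂ t θ) ^ 2 := by
  have sec : ∀ {F : ℝ → ℝ → ℝ}, Continuous (Function.uncurry F) → ∀ t, Continuous (F t) :=
    fun hF t => hF.comp (by fun_prop : Continuous fun s => (t, s))
  have param : ∀ {F : ℝ → ℝ → ℝ}, Continuous (Function.uncurry F) →
      Continuous fun t => ∫ θ in (-Real.pi)..Real.pi, F t θ ^ 2 := fun {F} hF =>
    intervalIntegral.continuous_parametric_intervalIntegral_of_continuous'
      (f := fun t θ => F t θ ^ 2) ((continuous_pow 2).comp hF) _ _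
  have cw : ∀ t k, cosCoeff k (w₁ t) = k * sinCoeff k (v t) := fun t k =>
    cosCoeff_deriv (dw t) (sec hw₁ t) (pv t) k
  have sw : ∀ t k, sinCoeff k (w₁ t) = -(k * cosCoeff k (v t)) := fun t k =>
    sinCoeff_deriv (dw t) (sec hw₁ t) k
  have cw₂ : ∀ t k, cosCoeff k (w₂ t) = -(k ^ 2 * cosCoeff k (v t)) := fun t k => by
    rw [cosCoeff_deriv (dw₁ t) (sec hw₂ t) (pw t) k, sw]; ring
  have sw₂ : ∀ t k, sinCoeff k (w₂ t) = -(k ^ 2 * sinCoeff k (v t)) := fun t k => by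
    rw [sinCoeff_deriv (dw₁ t) (sec hw₂ t) k, cw]; ring
  have hvw : Continuous (Function.uncurry fun t θ => v₂ t θ + w₂ t θ) := hv₂.add hw₂
  have cont := fun k => continuous_cosCoeff hv k
  have cont₁ := fun k => continuous_cosCoeff hv₁ k
  have cont₂ := fun k => continuous_cosCoeff hv₂ k
  have scont := fun k => continuous_sinCoeff hv k
  have scont₁ := fun k => continuous_sinCoeff hv₁ k
  have scont₂ := fun k => continuous_sinCoeff hv₂ k
  have pc := param hv₁
  have pc' := param hw₁
  have pcvw := param hvw
  have hN : ∀ t, HasSum (fun k : ℤ => Real.exp (-2 * a * t) *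
        ((cosCoeff k (v₂ t) - (k : ℝ) ^ 2 * cosCoeff k (v t)) ^ 2
          + (sinCoeff k (v₂ t) - (k : ℝ) ^ 2 * sinCoeff k (v t)) ^ 2))
      (Real.exp (-2 * a * t) *
        (2 * Real.pi * ∫ θ in (-Real.pi)..Real.pi, (v₂ t θ + w₂ t θ) ^ 2)) := by
    intro t
    have h := (hasSum_cosCoeff_sq_add_sinCoeff_sq (sec hvw t)).mul_left (Real.exp (-2 * a * t))
    simpa only [cosCoeff_add (sec hv₂ t) (sec hw₂ t), sinCoeff_add (sec hv₂ t) (sec hw₂ t),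
      cw₂, sw₂, ← sub_eq_add_neg] using h
  have hD : ∀ t, HasSum (fun k : ℤ => Real.exp (-2 * a * t) *
        (cosCoeff k (v₁ t) ^ 2 + (k : ℝ) ^ 2 * cosCoeff k (v t) ^ 2)
        + Real.exp (-2 * a * t) *
        (sinCoeff k (v₁ t) ^ 2 + (k : ℝ) ^ 2 * sinCoeff k (v t) ^ 2))
      (Real.exp (-2 * a * t) *
        (2 * Real.pi * (∫ θ in (-Real.pi)..Real.pi, v₁ t θ ^ 2)
          + 2 * Real.pi * ∫ θ in (-Real.pi)..Real.pi, w₁ t θ ^ 2)) := by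
    intro t
    have h := ((hasSum_cosCoeff_sq_add_sinCoeff_sq (sec hv₁ t)).add
      (hasSum_cosCoeff_sq_add_sinCoeff_sq (sec hw₁ t))).mul_left (Real.exp (-2 * a * t))
    refine h.congr_fun fun k => ?_
    rw [cw, sw]
    ring
  have hN' := hasSum_intervalIntegral_of_nonneg hT (fun k => by fun_prop) (by fun_prop)
    (fun k t => by positivity) hN
  have hD' := hasSum_intervalIntegral_of_nonneg hT (fun k => by fun_prop) (by fun_prop)
    (fun k t => by positivity) hD
  have zc : ∀ {F : ℝ → ℝ → ℝ}, (∀ θ, F T θ = 0 ∧ F (-T) θ = 0) → ∀ k,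
      (cosCoeff k (F T) = 0 ∧ cosCoeff k (F (-T)) = 0) ∧
      (sinCoeff k (F T) = 0 ∧ sinCoeff k (F (-T)) = 0) := by
    intro F hF k
    simp [cosCoeff, sinCoeff, hF]
  have key := hasSum_le (fun k => ?_) (hD'.mul_left δ) hN'
  · have e₁ : ∀ t, Real.exp (-2 * a * t) *
        (2 * Real.pi * (∫ θ in (-Real.pi)..Real.pi, v₁ t θ ^ 2)
          + 2 * Real.pi * ∫ θ in (-Real.pi)..Real.pi, w₁ t θ ^ 2) =
        2 * Real.pi * ∫ θ in (-Real.pi)..Real.pi,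
          Real.exp (-2 * a * t) * (v₁ t θ ^ 2 + w₁ t θ ^ 2) := by
      intro t
      have := sec hv₁ t
      have := sec hw₁ t
      rw [intervalIntegral.integral_const_mul, intervalIntegral.integral_add
        (Continuous.intervalIntegrable (by fun_prop) _ _)
        (Continuous.intervalIntegrable (by fun_prop) _ _)]
      ring
    have e₂ : ∀ t, Real.exp (-2 * a * t) *
        (2 * Real.pi * ∫ θ in (-Real.pi)..Real.pi, (v₂ t θ + w₂ t θ) ^ 2) =
        2 * Real.pi * ∫ θ in (-Real.pi)..Real.pi,
          Real.exp (-2 * a * t) * (v₂ t θ + w₂ t θ) ^ 2 := by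
      intro t
      rw [intervalIntegral.integral_const_mul]
      ring
    simp only [e₁, e₂, intervalIntegral.integral_const_mul (2 * Real.pi)] at key
    rw [mul_left_comm] at key
    exact le_of_mul_le_mul_left key (by positivity)
  · have hm : (0 : ℝ) < (k : ℝ) ^ 2 + a ^ 2 := by positivity
    have hc := mode_inequality (cosCoeff_hasDerivAt hv hv₁ dv k) (cosCoeff_hasDerivAt hv₁ hv₂ dv₁ k)
      (cont₂ k) hT (zc zv k).1 (zc zv₁ k).1 (sq_nonneg (k : ℝ)) hm (hδ k)
    have hs := mode_inequality (sinCoeff_hasDerivAt hv hv₁ dv k) (sinCoeff_hasDerivAt hv₁ hv₂ dv₁ k)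
      (scont₂ k) hT (zc zv k).2 (zc zv₁ k).2 (sq_nonneg (k : ℝ)) hm (hδ k)
    have := cont k
    have := cont₁ k
    have := scont k
    have := scont₁ k
    have := cont₂ k
    have := scont₂ k
    simp only [mul_add (Real.exp _) ((_ - _) ^ 2)]
    rw [intervalIntegral.integral_add (Continuous.intervalIntegrable (by fun_prop) _ _)
        (Continuous.intervalIntegrable (by fun_prop) _ _),
      intervalIntegral.integral_add (Continuous.intervalIntegrable (by fun_prop) _ _)
        (Continuous.intervalIntegrable (by fun_prop) _ _), mul_add]
    exact add_le_add hc hs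

/-- The point of the plane with logarithmic polar coordinates `(t, θ)`. -/
noncomputable def logPolar (t θ : ℝ) : EuclideanSpace ℝ (Fin 2) :=
  (Real.exp t * Real.cos θ) • EuclideanSpace.single 0 1 +
    (Real.exp t * Real.sin θ) • EuclideanSpace.single 1 1

/-- The angular derivative of `logPolar`. -/
noncomputable def logPolarAngular (t θ : ℝ) : EuclideanSpace ℝ (Fin 2) :=
  (-(Real.exp t * Real.sin θ)) • EuclideanSpace.single 0 1 +
    (Real.exp t * Real.cos θ) • EuclideanSpace.single 1 1

theorem logPolar_eq (t θ : ℝ) :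
    logPolar t θ = WithLp.toLp 2 ![Real.exp t * Real.cos θ, Real.exp t * Real.sin θ] := by
  ext i
  fin_cases i <;> simp [logPolar]

theorem norm_logPolar (t θ : ℝ) : ‖logPolar t θ‖ = Real.exp t := by
  rw [logPolar_eq, EuclideanSpace.norm_eq, Real.sqrt_eq_iff_eq_sq (by positivity) (by positivity)]
  simp only [Fin.sum_univ_two, Real.norm_eq_abs, sq_abs, Matrix.cons_val_zero, Matrix.cons_val_one]
  linear_combination (Real.exp t) ^ 2 * Real.cos_sq_add_sin_sq θ

theorem continuous_logPolar : Continuous (Function.uncurry logPolar) := by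
  unfold logPolar Function.uncurry
  fun_prop

theorem continuous_logPolarAngular : Continuous (Function.uncurry logPolarAngular) := by
  unfold logPolarAngular Function.uncurry
  fun_prop

theorem hasDerivAt_logPolar_radial (t θ : ℝ) :
    HasDerivAt (fun t => logPolar t θ) (logPolar t θ) t :=
  (((Real.hasDerivAt_exp t).mul_const _).smul_const _).add
    (((Real.hasDerivAt_exp t).mul_const _).smul_const _)

theorem hasDerivAt_logPolar_angular (t θ : ℝ) :
    HasDerivAt (fun θ => logPolar t θ) (logPolarAngular t θ) θ := by
  have h := (((Real.hasDerivAt_cos θ).const_mul (Real.exp t)).smul_const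
    (EuclideanSpace.single (0 : Fin 2) (1 : ℝ))).add
    (((Real.hasDerivAt_sin θ).const_mul (Real.exp t)).smul_const
    (EuclideanSpace.single (1 : Fin 2) (1 : ℝ)))
  rw [mul_neg] at h
  exact h

theorem hasDerivAt_logPolarAngular_angular (t θ : ℝ) :
    HasDerivAt (fun θ => logPolarAngular t θ) (-logPolar t θ) θ := by
  have h := ((((Real.hasDerivAt_sin θ).const_mul (Real.exp t)).neg).smul_const
    (EuclideanSpace.single (0 : Fin 2) (1 : ℝ))).add
    (((Real.hasDerivAt_cos θ).const_mul (Real.exp t)).smul_const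
    (EuclideanSpace.single (1 : Fin 2) (1 : ℝ)))
  convert! h using 1
  rw [logPolar, neg_add, mul_neg, neg_smul, neg_smul]

theorem integral_eq_logPolar {h : EuclideanSpace ℝ (Fin 2) → ℝ} (hc : ContinuousOn h {0}ᶜ)
    {T : ℝ} (hT : -T ≤ T)
    (hs : ∀ x, h x ≠ 0 → Real.exp (-T) < ‖x‖ ∧ ‖x‖ < Real.exp T) :
    ∫ x, h x = ∫ t in (-T)..T, ∫ θ in (-Real.pi)..Real.pi,
      Real.exp (2 * t) * h (logPolar t θ) := by
  have hπ : -Real.pi ≤ Real.pi := by linarith [Real.pi_pos]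
  let c : ℝ × ℝ → EuclideanSpace ℝ (Fin 2) := fun p => WithLp.toLp 2 ![p.1, p.2]
  have hcont : Continuous c := by fun_prop
  have hmp : MeasurePreserving c :=
    (PiLp.volume_preserving_toLp (Fin 2)).comp (volume_preserving_finTwoArrow ℝ).symm
  have hemb : MeasurableEmbedding c :=
    (MeasurableEquiv.toLp 2 (Fin 2 → ℝ)).measurableEmbedding.comp
      (MeasurableEquiv.finTwoArrow (α := ℝ)).symm.measurableEmbedding
  let G : ℝ → ℝ → ℝ := fun r θ => r * h (c (r * Real.cos θ, r * Real.sin θ))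
  have hnorm : ∀ r θ : ℝ, 0 < r → ‖c (r * Real.cos θ, r * Real.sin θ)‖ = r := by
    intro r θ hr
    have := norm_logPolar (Real.log r) θ
    rwa [logPolar_eq, Real.exp_log hr] at this
  have hle : Real.exp (-T) ≤ Real.exp T := Real.exp_le_exp.2 hT
  have hh : Continuous h := by
    refine continuous_iff_continuousAt.2 fun x => ?_
    rcases eq_or_ne x 0 with rfl | hx
    · have h0 : h =ᶠ[nhds 0] fun _ => 0 := by
        filter_upwards [Metric.ball_mem_nhds 0 (Real.exp_pos (-T))] with y hy
        by_contra hy'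
        exact lt_asymm (hs y hy').1 (mem_ball_zero_iff.1 hy)
      exact continuousAt_const.congr h0.symm
    · exact hc.continuousAt (isOpen_compl_singleton.mem_nhds hx)
  have hGc : Continuous (Function.uncurry G) := by
    simp only [G, Function.uncurry_def]
    fun_prop
  have step : ∫ x, h x = ∫ p in Set.Ioi (0 : ℝ) ×ˢ Set.Ioo (-Real.pi) Real.pi,
      Function.uncurry G p := by
    rw [← hmp.integral_comp hemb, ← integral_comp_polarCoord_symm]
    rfl
  have step₂ : ∫ p in Set.Ioi (0 : ℝ) ×ˢ Set.Ioo (-Real.pi) Real.pi, Function.uncurry G p =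
      ∫ p in Set.Ioc (Real.exp (-T)) (Real.exp T) ×ˢ Set.Ioo (-Real.pi) Real.pi,
        Function.uncurry G p := by
    refine setIntegral_eq_of_subset_of_forall_sdiff_eq_zero
      (measurableSet_Ioi.prod measurableSet_Ioo)
      (Set.prod_mono (fun r hr => (Real.exp_pos _).trans hr.1) le_rfl) ?_
    rintro ⟨r, θ⟩ ⟨⟨hr, hθ⟩, hn⟩
    by_contra h0
    have := hs _ (right_ne_zero_of_mul h0)
    rw [hnorm r θ hr] at this
    exact hn ⟨⟨this.1, this.2.le⟩, hθ⟩
  have hint : IntegrableOn (Function.uncurry G)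
      (Set.Ioc (Real.exp (-T)) (Real.exp T) ×ˢ Set.Ioo (-Real.pi) Real.pi)
      ((volume : Measure ℝ).prod volume) :=
    (hGc.continuousOn.integrableOn_compact (isCompact_Icc.prod isCompact_Icc)).mono_set
      (Set.prod_mono Set.Ioc_subset_Icc_self Set.Ioo_subset_Icc_self)
  rw [step, step₂, Measure.volume_eq_prod, setIntegral_prod _ hint,
    ← intervalIntegral.integral_of_le hle]
  simp_rw [← integral_Ioc_eq_integral_Ioo, ← intervalIntegral.integral_of_le hπ]
  simp only [Function.uncurry_apply_pair]
  rw [← intervalIntegral.integral_comp_mul_deriv (f := Real.exp) (f' := Real.exp)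
    (g := fun r => ∫ θ in (-Real.pi)..Real.pi, G r θ)
    (fun t _ => Real.hasDerivAt_exp t) Real.continuous_exp.continuousOn
    (intervalIntegral.continuous_parametric_intervalIntegral_of_continuous' hGc _ _)]
  refine intervalIntegral.integral_congr fun t _ => ?_
  simp only [Function.comp]
  rw [← intervalIntegral.integral_mul_const]
  refine intervalIntegral.integral_congr fun θ _ => ?_
  simp only [G, c, logPolar_eq]
  rw [two_mul, Real.exp_add]
  ring

theorem norm_gradient_sq (u : EuclideanSpace ℝ (Fin 2) → ℝ) (x : EuclideanSpace ℝ (Fin 2)) :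
    ‖gradient u x‖ ^ 2 = fderiv ℝ u x (EuclideanSpace.single 0 1) ^ 2 +
      fderiv ℝ u x (EuclideanSpace.single 1 1) ^ 2 := by
  have h : ∀ i, gradient u x i = fderiv ℝ u x (EuclideanSpace.single i 1) := by
    intro i
    rw [gradient, ← InnerProductSpace.toDual_symm_apply, EuclideanSpace.inner_single_right]
    simp
  simp [EuclideanSpace.norm_sq_eq, Fin.sum_univ_two, h]

theorem norm_gradient_logPolar (u : EuclideanSpace ℝ (Fin 2) → ℝ) (t θ : ℝ) :
    Real.exp (2 * t) * ‖gradient u (logPolar t θ)‖ ^ 2 =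
      fderiv ℝ u (logPolar t θ) (logPolar t θ) ^ 2 +
        fderiv ℝ u (logPolar t θ) (logPolarAngular t θ) ^ 2 := by
  rw [norm_gradient_sq, two_mul, Real.exp_add]
  generalize fderiv ℝ u (logPolar t θ) = D
  simp only [logPolar, logPolarAngular, map_add, map_smul, smul_eq_mul]
  linear_combination (-Real.exp t ^ 2 * (D (EuclideanSpace.single 0 1) ^ 2 +
    D (EuclideanSpace.single 1 1) ^ 2)) * Real.cos_sq_add_sin_sq θ

theorem lap_logPolar (u : EuclideanSpace ℝ (Fin 2) → ℝ) (t θ : ℝ) :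
    Real.exp (2 * t) * lap u (logPolar t θ) =
      fderiv ℝ (fderiv ℝ u) (logPolar t θ) (logPolar t θ) (logPolar t θ) +
        fderiv ℝ (fderiv ℝ u) (logPolar t θ) (logPolarAngular t θ) (logPolarAngular t θ) := by
  simp only [lap, Fin.sum_univ_two, iteratedFDeriv_two_apply, Matrix.cons_val_zero,
    Matrix.cons_val_one]
  rw [two_mul, Real.exp_add]
  generalize fderiv ℝ (fderiv ℝ u) (logPolar t θ) = D
  simp only [logPolar, logPolarAngular, map_add, map_smul, smul_eq_mul,
    add_apply, smul_apply]
  linear_combination (-Real.exp t ^ 2 * (D (EuclideanSpace.single 0 1) (EuclideanSpace.single 0 1) +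
    D (EuclideanSpace.single 1 1) (EuclideanSpace.single 1 1))) * Real.cos_sq_add_sin_sq θ

section Derivatives

variable {u : EuclideanSpace ℝ (Fin 2) → ℝ} (hu : ContDiff ℝ 2 u)
include hu

theorem hasDerivAt_comp_logPolar_radial (t θ : ℝ) :
    HasDerivAt (fun t => u (logPolar t θ)) (fderiv ℝ u (logPolar t θ) (logPolar t θ)) t :=
  (hu.differentiable (by norm_num) _).hasFDerivAt.comp_hasDerivAt t
    (hasDerivAt_logPolar_radial t θ)

theorem hasDerivAt_comp_logPolar_angular (t θ : ℝ) :
    HasDerivAt (fun θ => u (logPolar t θ)) (fderiv ℝ u (logPolar t θ) (logPolarAngular t θ)) θ :=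
  (hu.differentiable (by norm_num) _).hasFDerivAt.comp_hasDerivAt θ
    (hasDerivAt_logPolar_angular t θ)

theorem hasDerivAt_fderiv_logPolar_radial (t θ : ℝ) :
    HasDerivAt (fun t => fderiv ℝ u (logPolar t θ) (logPolar t θ))
      (fderiv ℝ (fderiv ℝ u) (logPolar t θ) (logPolar t θ) (logPolar t θ) +
        fderiv ℝ u (logPolar t θ) (logPolar t θ)) t :=
  (((hu.fderiv_right (m := 1) (by norm_num)).differentiable
    (by norm_num) _).hasFDerivAt.comp_hasDerivAt t (hasDerivAt_logPolar_radial t θ)).clm_apply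
    (hasDerivAt_logPolar_radial t θ)

theorem hasDerivAt_fderiv_logPolar_angular (t θ : ℝ) :
    HasDerivAt (fun θ => fderiv ℝ u (logPolar t θ) (logPolarAngular t θ))
      (fderiv ℝ (fderiv ℝ u) (logPolar t θ) (logPolarAngular t θ) (logPolarAngular t θ) -
        fderiv ℝ u (logPolar t θ) (logPolar t θ)) θ := by
  have h := (((hu.fderiv_right (m := 1) (by norm_num)).differentiable
    (by norm_num) _).hasFDerivAt.comp_hasDerivAt θ (hasDerivAt_logPolar_angular t θ)).clm_apply
    (hasDerivAt_logPolarAngular_angular t θ)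
  rw [map_neg, ← sub_eq_add_neg] at h
  exact h

theorem continuous_fderiv_fderiv : Continuous (fderiv ℝ (fderiv ℝ u)) :=
  (hu.fderiv_right (m := 1) (by norm_num)).continuous_fderiv (by norm_num)

theorem continuous_lap : Continuous (lap u) := by
  have := continuous_fderiv_fderiv hu
  unfold lap
  simp only [iteratedFDeriv_two_apply]
  fun_prop

theorem integral_gradient_eq {α a T : ℝ} (ha : -2 * a = α - 2) (hT : -T ≤ T)
    (hs : ∀ x ∈ tsupport u, Real.exp (-T) < ‖x‖ ∧ ‖x‖ < Real.exp T) {v₁ w₁ : ℝ → ℝ → ℝ}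
    (dv : ∀ t θ, HasDerivAt (fun t => u (logPolar t θ)) (v₁ t θ) t)
    (dw : ∀ t θ, HasDerivAt (fun θ => u (logPolar t θ)) (w₁ t θ) θ) :
    ∫ x, ‖x‖ ^ (α - 2) * ‖gradient u x‖ ^ 2 =
      ∫ t in (-T)..T, ∫ θ in (-Real.pi)..Real.pi,
        Real.exp (-2 * a * t) * (v₁ t θ ^ 2 + w₁ t θ ^ 2) := by
  rw [integral_eq_logPolar _ hT]
  · refine intervalIntegral.integral_congr fun t _ => intervalIntegral.integral_congr fun θ _ => ?_
    beta_reduce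
    rw [(dv t θ).unique (hasDerivAt_comp_logPolar_radial hu t θ),
      (dw t θ).unique (hasDerivAt_comp_logPolar_angular hu t θ), ← norm_gradient_logPolar,
      norm_logPolar, ha, mul_comm (α - 2) t, Real.exp_mul t (α - 2)]
    ring
  · intro x hx
    refine hs x (support_fderiv_subset ℝ fun h0 => hx ?_)
    simp [gradient, h0]
  · have := hu.continuous_fderiv (by norm_num)
    refine ContinuousOn.mul (continuousOn_id.norm.rpow_const fun x hx => ?_) ?_
    · exact Or.inl (norm_ne_zero_iff.2 hx)
    · simp only [norm_gradient_sq]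
      fun_prop

theorem integral_lap_eq {α a T : ℝ} (ha : -2 * a = α - 2) (hT : -T ≤ T)
    (hs : ∀ x ∈ tsupport u, Real.exp (-T) < ‖x‖ ∧ ‖x‖ < Real.exp T) {v₁ v₂ w₁ w₂ : ℝ → ℝ → ℝ}
    (dv : ∀ t θ, HasDerivAt (fun t => u (logPolar t θ)) (v₁ t θ) t)
    (dv₁ : ∀ t θ, HasDerivAt (fun t => v₁ t θ) (v₂ t θ) t)
    (dw : ∀ t θ, HasDerivAt (fun θ => u (logPolar t θ)) (w₁ t θ) θ)
    (dw₁ : ∀ t θ, HasDerivAt (fun θ => w₁ t θ) (w₂ t θ) θ) :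
    ∫ x, ‖x‖ ^ α * lap u x ^ 2 =
      ∫ t in (-T)..T, ∫ θ in (-Real.pi)..Real.pi,
        Real.exp (-2 * a * t) * (v₂ t θ + w₂ t θ) ^ 2 := by
  obtain rfl : v₁ = fun t θ => fderiv ℝ u (logPolar t θ) (logPolar t θ) := by
    ext t θ
    exact (dv t θ).unique (hasDerivAt_comp_logPolar_radial hu t θ)
  obtain rfl : w₁ = fun t θ => fderiv ℝ u (logPolar t θ) (logPolarAngular t θ) := by
    ext t θ
    exact (dw t θ).unique (hasDerivAt_comp_logPolar_angular hu t θ)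
  rw [integral_eq_logPolar _ hT]
  · refine intervalIntegral.integral_congr fun t _ => intervalIntegral.integral_congr fun θ _ => ?_
    rw [(dv₁ t θ).unique (hasDerivAt_fderiv_logPolar_radial hu t θ),
      (dw₁ t θ).unique (hasDerivAt_fderiv_logPolar_angular hu t θ), add_add_sub_cancel,
      ← lap_logPolar, norm_logPolar, ha, mul_pow, ← Real.exp_nat_mul, ← mul_assoc, ← mul_assoc,
      ← Real.exp_mul, ← Real.exp_add, ← Real.exp_add]
    congr 2
    push_cast
    ring
  · intro x hx
    refine hs x (tsupport_fderiv_subset ℝ (f := u)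
      (support_fderiv_subset ℝ (f := fderiv ℝ u) fun h0 => hx ?_))
    simp [lap, iteratedFDeriv_two_apply, h0]
  · have := continuous_lap hu
    refine ContinuousOn.mul (continuousOn_id.norm.rpow_const fun x hx => ?_) (by fun_prop)
    exact Or.inl (norm_ne_zero_iff.2 hx)

/-- The weighted Rellich-type inequality for functions supported in an annulus. -/
theorem integral_gradient_le_integral_lap {α a T δ : ℝ} (ha : -2 * a = α - 2) (ha₀ : a ≠ 0)
    (hT : -T ≤ T) (hs : ∀ x ∈ tsupport u, Real.exp (-T) < ‖x‖ ∧ ‖x‖ < Real.exp T)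
    (hδ : ∀ k : ℤ, δ * ((k : ℝ) ^ 2 + a ^ 2) ≤ ((k : ℝ) ^ 2 - a ^ 2) ^ 2) :
    δ * ∫ x, ‖x‖ ^ (α - 2) * ‖gradient u x‖ ^ 2 ≤ ∫ x, ‖x‖ ^ α * lap u x ^ 2 := by
  rw [integral_gradient_eq hu ha hT hs (hasDerivAt_comp_logPolar_radial hu)
    (hasDerivAt_comp_logPolar_angular hu), integral_lap_eq hu ha hT hs
    (hasDerivAt_comp_logPolar_radial hu) (hasDerivAt_fderiv_logPolar_radial hu)
    (hasDerivAt_comp_logPolar_angular hu) (hasDerivAt_fderiv_logPolar_angular hu)]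
  have c₀ := hu.continuous
  have c₁ := hu.continuous_fderiv (by norm_num)
  have c₂ := continuous_fderiv_fderiv hu
  have cP := continuous_logPolar
  have cQ := continuous_logPolarAngular
  have cu₁ := c₁.comp cP
  have cu₂ := c₂.comp cP
  have hP : ∀ t, logPolar t Real.pi = logPolar t (-Real.pi) := by simp [logPolar]
  have hQ : ∀ t, logPolarAngular t Real.pi = logPolarAngular t (-Real.pi) := by
    simp [logPolarAngular]
  have hout : ∀ θ, logPolar T θ ∉ tsupport u ∧ logPolar (-T) θ ∉ tsupport u := by
    refine fun θ => ⟨fun h => ?_, fun h => ?_⟩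
    · exact (hs _ h).2.ne (norm_logPolar _ _)
    · exact (hs _ h).1.ne' (norm_logPolar _ _)
  have hf : ∀ {x}, x ∉ tsupport u → fderiv ℝ u x = 0 := fun hx =>
    Function.notMem_support.1 fun h => hx (support_fderiv_subset ℝ h)
  refine cylinder_inequality (v := fun t θ => u (logPolar t θ))
    (v₁ := fun t θ => fderiv ℝ u (logPolar t θ) (logPolar t θ))
    (v₂ := fun t θ => fderiv ℝ (fderiv ℝ u) (logPolar t θ) (logPolar t θ) (logPolar t θ) +
      fderiv ℝ u (logPolar t θ) (logPolar t θ))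
    (w₁ := fun t θ => fderiv ℝ u (logPolar t θ) (logPolarAngular t θ))
    (w₂ := fun t θ => fderiv ℝ (fderiv ℝ u) (logPolar t θ) (logPolarAngular t θ)
      (logPolarAngular t θ) - fderiv ℝ u (logPolar t θ) (logPolar t θ)) (c₀.comp cP) (cu₁.clm_apply cP)
    (((cu₂.clm_apply cP).clm_apply cP).add (cu₁.clm_apply cP)) (cu₁.clm_apply cQ)
    (((cu₂.clm_apply cQ).clm_apply cQ).sub (cu₁.clm_apply cP))
    (hasDerivAt_comp_logPolar_radial hu) (hasDerivAt_fderiv_logPolar_radial hu)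
    (hasDerivAt_comp_logPolar_angular hu) (hasDerivAt_fderiv_logPolar_angular hu)
    (fun t => by rw [hP]) (fun t => by rw [hP, hQ]) hT
    (fun θ => ⟨image_eq_zero_of_notMem_tsupport (hout θ).1,
      image_eq_zero_of_notMem_tsupport (hout θ).2⟩)
    (fun θ => ⟨by simp [hf (hout θ).1], by simp [hf (hout θ).2]⟩) ha₀ hδ

end Derivatives

theorem exists_annulus_of_tsupport {u : EuclideanSpace ℝ (Fin 2) → ℝ} (hu : HasCompactSupport u)
    (h0 : (0 : EuclideanSpace ℝ (Fin 2)) ∉ tsupport u) :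
    ∃ T : ℝ, -T ≤ T ∧ ∀ x ∈ tsupport u, Real.exp (-T) < ‖x‖ ∧ ‖x‖ < Real.exp T := by
  obtain ⟨ε, hε, hball⟩ := Metric.isOpen_iff.1 (isClosed_tsupport u).isOpen_compl 0 h0
  obtain ⟨R, hR⟩ := hu.isCompact.isBounded.exists_norm_le
  refine ⟨max 0 (max (-Real.log ε + 1) R), ?_, fun x hx => ⟨?_, ?_⟩⟩
  · linarith [le_max_left 0 (max (-Real.log ε + 1) R)]
  · have h₁ : ε ≤ ‖x‖ := by
      by_contra! h
      exact hball (mem_ball_zero_iff.2 h) hx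
    refine lt_of_lt_of_le ?_ h₁
    rw [← Real.lt_log_iff_exp_lt hε]
    have := (le_max_left (-Real.log ε + 1) R).trans (le_max_right 0 _)
    linarith
  · have := (le_max_right (-Real.log ε + 1) R).trans (le_max_right 0 _)
    linarith [hR x hx, Real.add_one_le_exp (max 0 (max (-Real.log ε + 1) R))]

/-- A radial cut-off, in logarithmic scale, of the `k`-th angular mode. -/
noncomputable def modeTest (φ : ℝ → ℝ) (a : ℝ) (k : ℕ) (ε : ℝ)
    (x : EuclideanSpace ℝ (Fin 2)) : ℝ :=
  Real.exp ((a - k) * Real.log ‖x‖) * φ (ε * Real.log ‖x‖) *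
    (((x 0 : ℂ) + x 1 * Complex.I) ^ k).re

theorem modeTest_logPolar (φ : ℝ → ℝ) (a : ℝ) (k : ℕ) (ε t θ : ℝ) :
    modeTest φ a k ε (logPolar t θ) = Real.exp (a * t) * φ (ε * t) * Real.cos (k * θ) := by
  have h : (((logPolar t θ 0 : ℝ) : ℂ) + (logPolar t θ 1 : ℝ) * Complex.I) ^ k =
      (Real.exp (k * t) : ℝ) * ((Real.cos (k * θ) : ℝ) + (Real.sin (k * θ) : ℝ) * Complex.I) := by
    have hb : ((logPolar t θ 0 : ℝ) : ℂ) + (logPolar t θ 1 : ℝ) * Complex.I =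
        (Real.exp t : ℝ) * (Complex.cos θ + Complex.sin θ * Complex.I) := by
      simp [logPolar_eq]
      ring
    rw [hb, mul_pow, Complex.cos_add_sin_mul_I_pow, Real.exp_nat_mul]
    push_cast
    rfl
  rw [modeTest, norm_logPolar, Real.log_exp, h, Complex.re_ofReal_mul,
    show a * t = (a - k) * t + k * t by ring, Real.exp_add]
  simp only [Complex.add_re, Complex.ofReal_re, Complex.mul_re, Complex.I_re, Complex.ofReal_im,
    Complex.I_im]
  ring

section ModeTest

variable {φ : ℝ → ℝ} {ε : ℝ} (hε : 0 < ε) (hs : ∀ s, φ s ≠ 0 → 1 ≤ s ∧ s ≤ 3)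
include hε hs

theorem norm_mem_of_modeTest_ne_zero {a : ℝ} {k : ℕ} {x : EuclideanSpace ℝ (Fin 2)}
    (hx : modeTest φ a k ε x ≠ 0) : Real.exp (1 / ε) ≤ ‖x‖ ∧ ‖x‖ ≤ Real.exp (3 / ε) := by
  obtain ⟨h₁, h₃⟩ := hs _ (right_ne_zero_of_mul (left_ne_zero_of_mul hx))
  have hlog : Real.log ‖x‖ ≠ 0 := by
    intro h
    rw [h, mul_zero] at h₁
    linarith
  have hpos : 0 < ‖x‖ := lt_of_le_of_ne (norm_nonneg x) fun h => hlog (by simp [← h])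
  rw [← Real.le_log_iff_exp_le hpos, ← Real.log_le_iff_le_exp hpos, div_le_iff₀' hε,
    le_div_iff₀' hε]
  exact ⟨h₁, h₃⟩

theorem norm_mem_of_mem_tsupport_modeTest {a : ℝ} {k : ℕ} :
    ∀ x ∈ tsupport (modeTest φ a k ε), Real.exp (-(4 / ε)) < ‖x‖ ∧ ‖x‖ < Real.exp (4 / ε) := by
  have hcl : IsClosed {x : EuclideanSpace ℝ (Fin 2) |
      Real.exp (1 / ε) ≤ ‖x‖ ∧ ‖x‖ ≤ Real.exp (3 / ε)} :=
    (isClosed_le continuous_const continuous_norm).inter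
      (isClosed_le continuous_norm continuous_const)
  intro x hx
  obtain ⟨h₁, h₃⟩ := closure_minimal (fun y hy => norm_mem_of_modeTest_ne_zero hε hs hy) hcl hx
  refine ⟨lt_of_lt_of_le (Real.exp_lt_exp.2 ?_) h₁, lt_of_le_of_lt h₃ (Real.exp_lt_exp.2 ?_)⟩
  · have h1 : 0 < 1 / ε := by positivity
    have h4 : 0 < 4 / ε := by positivity
    linarith
  · gcongr
    norm_num

theorem hasCompactSupport_modeTest (a : ℝ) (k : ℕ) : HasCompactSupport (modeTest φ a k ε) :=
  HasCompactSupport.of_support_subset_isCompact (isCompact_closedBall 0 (Real.exp (3 / ε)))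
    fun _ hx => mem_closedBall_zero_iff.2 (norm_mem_of_modeTest_ne_zero hε hs hx).2

theorem zero_notMem_tsupport_modeTest (a : ℝ) (k : ℕ) : 0 ∉ tsupport (modeTest φ a k ε) := by
  intro h
  have := (norm_mem_of_mem_tsupport_modeTest hε hs 0 h).1
  rw [norm_zero] at this
  exact this.not_gt (Real.exp_pos _)

theorem contDiff_modeTest (hφ : ContDiff ℝ 2 φ) (a : ℝ) (k : ℕ) :
    ContDiff ℝ 2 (modeTest φ a k ε) := by
  refine contDiff_iff_contDiffAt.2 fun x => ?_
  rcases eq_or_ne x 0 with rfl | hx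
  · refine (contDiffAt_const (c := (0 : ℝ))).congr_of_eventuallyEq ?_
    exact notMem_tsupport_iff_eventuallyEq.1 (zero_notMem_tsupport_modeTest hε hs a k)
  · have hlog : ContDiffAt ℝ 2 (fun x : EuclideanSpace ℝ (Fin 2) => Real.log ‖x‖) x :=
      (contDiffAt_norm ℝ hx).log (norm_ne_zero_iff.2 hx)
    have hre : ContDiff ℝ 2 fun x : EuclideanSpace ℝ (Fin 2) =>
        (((x 0 : ℂ) + x 1 * Complex.I) ^ k).re := by
      have h : ∀ i, ContDiff ℝ 2 fun x : EuclideanSpace ℝ (Fin 2) => (x i : ℂ) := fun i =>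
        Complex.ofRealCLM.contDiff.comp (by fun_prop : ContDiff ℝ 2
          fun x : EuclideanSpace ℝ (Fin 2) => x i)
      exact Complex.reCLM.contDiff.comp (((h 0).add ((h 1).mul contDiff_const)).pow k)
    exact (((contDiffAt_const.mul hlog).exp).mul
      (hφ.contDiffAt.comp x (contDiffAt_const.mul hlog))).mul hre.contDiffAt

end ModeTest

theorem sq_mul_integral_sin_sq (k : ℕ) :
    (k : ℝ) ^ 2 * ∫ θ in (-Real.pi)..Real.pi, Real.sin (k * θ) ^ 2 =
      (k : ℝ) ^ 2 * ∫ θ in (-Real.pi)..Real.pi, Real.cos (k * θ) ^ 2 := by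
  have hd : ∀ θ, HasDerivAt (fun θ => k * (Real.sin (k * θ) * Real.cos (k * θ)))
      ((k : ℝ) ^ 2 * Real.cos (k * θ) ^ 2 - (k : ℝ) ^ 2 * Real.sin (k * θ) ^ 2) θ := by
    intro θ
    have hl := (hasDerivAt_id θ).const_mul (k : ℝ)
    convert! (hl.sin.mul hl.cos).const_mul (k : ℝ) using 1
    simp
    ring
  have h := intervalIntegral.integral_eq_sub_of_hasDerivAt (a := -Real.pi) (b := Real.pi)
    (fun θ _ => hd θ) (Continuous.intervalIntegrable (by fun_prop) _ _)
  rw [intervalIntegral.integral_sub (Continuous.intervalIntegrable (by fun_prop) _ _)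
    (Continuous.intervalIntegrable (by fun_prop) _ _), intervalIntegral.integral_const_mul,
    intervalIntegral.integral_const_mul] at h
  simp [Real.sin_nat_mul_pi] at h
  linarith

theorem integral_cos_nat_mul_sq_pos (k : ℕ) :
    0 < ∫ θ in (-Real.pi)..Real.pi, Real.cos (k * θ) ^ 2 := by
  have hπ := Real.pi_pos
  refine intervalIntegral.integral_pos (by linarith) (by fun_prop) (fun θ _ => sq_nonneg _)
    ⟨0, ⟨by linarith, hπ.le⟩, by simp⟩

section ModeEnergy

variable {φ φ₁ φ₂ : ℝ → ℝ} (h₁ : ∀ s, HasDerivAt φ (φ₁ s) s) (h₂ : ∀ s, HasDerivAt φ₁ (φ₂ s) s)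

/-- The reduced gradient energy of `modeTest`. -/
noncomputable def modeGradientEnergy (φ φ₁ : ℝ → ℝ) (a : ℝ) (k : ℕ) (ε : ℝ) : ℝ :=
  ∫ s in (-4)..4, ((a * φ s + ε * φ₁ s) ^ 2 + (k : ℝ) ^ 2 * φ s ^ 2)

/-- The reduced Laplacian energy of `modeTest`. -/
noncomputable def modeLapEnergy (φ φ₁ φ₂ : ℝ → ℝ) (a : ℝ) (k : ℕ) (ε : ℝ) : ℝ :=
  ∫ s in (-4)..4, ((a ^ 2 - (k : ℝ) ^ 2) * φ s + 2 * a * ε * φ₁ s + ε ^ 2 * φ₂ s) ^ 2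

include h₁ in
theorem hasDerivAt_exp_mul_comp_mul (a ε c t : ℝ) :
    HasDerivAt (fun t => Real.exp (a * t) * φ (ε * t) * c)
      (Real.exp (a * t) * (a * φ (ε * t) + ε * φ₁ (ε * t)) * c) t := by
  have he := ((hasDerivAt_id t).const_mul a).exp
  have hf : HasDerivAt (fun t => φ (ε * t)) (φ₁ (ε * t) * (ε * 1)) t :=
    (h₁ (ε * t)).comp t ((hasDerivAt_id t).const_mul ε)
  convert! (he.mul hf).mul_const c using 1
  simp only [id, mul_one]
  ring

variable {ε : ℝ} (hε : 0 < ε) (hs : ∀ s, φ s ≠ 0 → 1 ≤ s ∧ s ≤ 3) (hφ : ContDiff ℝ 2 φ)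
include h₁ hε hs hφ

theorem integral_gradient_modeTest {α a : ℝ} (ha : -2 * a = α - 2) (k : ℕ) :
    ∫ x, ‖x‖ ^ (α - 2) * ‖gradient (modeTest φ a k ε) x‖ ^ 2 =
      (∫ θ in (-Real.pi)..Real.pi, Real.cos (k * θ) ^ 2) * ε⁻¹ *
        modeGradientEnergy φ φ₁ a k ε := by
  have h4 : 0 < 4 / ε := by positivity
  rw [integral_gradient_eq (contDiff_modeTest hε hs hφ a k) ha (T := 4 / ε) (by linarith)
    (norm_mem_of_mem_tsupport_modeTest hε hs)
    (v₁ := fun t θ => Real.exp (a * t) * (a * φ (ε * t) + ε * φ₁ (ε * t)) * Real.cos (k * θ))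
    (w₁ := fun t θ => Real.exp (a * t) * φ (ε * t) * (-(k * Real.sin (k * θ))))]
  · have inner : ∀ t, ∫ θ in (-Real.pi)..Real.pi, Real.exp (-2 * a * t) *
        ((Real.exp (a * t) * (a * φ (ε * t) + ε * φ₁ (ε * t)) * Real.cos (k * θ)) ^ 2 +
          (Real.exp (a * t) * φ (ε * t) * (-(k * Real.sin (k * θ)))) ^ 2) =
        (∫ θ in (-Real.pi)..Real.pi, Real.cos (k * θ) ^ 2) *
          ((a * φ (ε * t) + ε * φ₁ (ε * t)) ^ 2 + (k : ℝ) ^ 2 * φ (ε * t) ^ 2) := by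
      intro t
      have hexp : Real.exp (-2 * a * t) * Real.exp (a * t) ^ 2 = 1 := by
        rw [← Real.exp_nat_mul, ← Real.exp_add, Real.exp_eq_one_iff]
        push_cast
        ring
      calc
        _ = ∫ θ in (-Real.pi)..Real.pi, ((a * φ (ε * t) + ε * φ₁ (ε * t)) ^ 2 *
              Real.cos (k * θ) ^ 2 + φ (ε * t) ^ 2 * k ^ 2 * Real.sin (k * θ) ^ 2) := by
          refine intervalIntegral.integral_congr fun θ _ => ?_
          linear_combination ((a * φ (ε * t) + ε * φ₁ (ε * t)) ^ 2 * Real.cos (k * θ) ^ 2 +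
            φ (ε * t) ^ 2 * k ^ 2 * Real.sin (k * θ) ^ 2) * hexp
        _ = (a * φ (ε * t) + ε * φ₁ (ε * t)) ^ 2 *
              (∫ θ in (-Real.pi)..Real.pi, Real.cos (k * θ) ^ 2) +
            φ (ε * t) ^ 2 * k ^ 2 * ∫ θ in (-Real.pi)..Real.pi, Real.sin (k * θ) ^ 2 := by
          rw [intervalIntegral.integral_add (Continuous.intervalIntegrable (by fun_prop) _ _)
            (Continuous.intervalIntegrable (by fun_prop) _ _),
            intervalIntegral.integral_const_mul, intervalIntegral.integral_const_mul]
        _ = _ := by linear_combination φ (ε * t) ^ 2 * sq_mul_integral_sin_sq k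
    simp only [inner]
    rw [intervalIntegral.integral_const_mul, modeGradientEnergy,
      intervalIntegral.integral_comp_mul_left
        (fun s => (a * φ s + ε * φ₁ s) ^ 2 + (k : ℝ) ^ 2 * φ s ^ 2) hε.ne', mul_neg,
      mul_div_cancel₀ _ hε.ne', smul_eq_mul, mul_assoc]
  · intro t θ
    simp only [modeTest_logPolar]
    exact hasDerivAt_exp_mul_comp_mul h₁ a ε _ t
  · intro t θ
    simp only [modeTest_logPolar]
    convert! (((hasDerivAt_id θ).const_mul (k : ℝ)).cos).const_mul
      (Real.exp (a * t) * φ (ε * t)) using 1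
    simp only [id, mul_one]
    ring

include h₂ in
theorem integral_lap_modeTest {α a : ℝ} (ha : -2 * a = α - 2) (k : ℕ) :
    ∫ x, ‖x‖ ^ α * lap (modeTest φ a k ε) x ^ 2 =
      (∫ θ in (-Real.pi)..Real.pi, Real.cos (k * θ) ^ 2) * ε⁻¹ *
        modeLapEnergy φ φ₁ φ₂ a k ε := by
  have h4 : 0 < 4 / ε := by positivity
  rw [integral_lap_eq (contDiff_modeTest hε hs hφ a k) ha (T := 4 / ε) (by linarith)
    (norm_mem_of_mem_tsupport_modeTest hε hs)
    (v₁ := fun t θ => Real.exp (a * t) * (a * φ (ε * t) + ε * φ₁ (ε * t)) * Real.cos (k * θ))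
    (v₂ := fun t θ => Real.exp (a * t) * (a * (a * φ (ε * t) + ε * φ₁ (ε * t)) +
      ε * (a * φ₁ (ε * t) + ε * φ₂ (ε * t))) * Real.cos (k * θ))
    (w₁ := fun t θ => Real.exp (a * t) * φ (ε * t) * (-(k * Real.sin (k * θ))))
    (w₂ := fun t θ => Real.exp (a * t) * φ (ε * t) * (-(k ^ 2 * Real.cos (k * θ))))]
  · have inner : ∀ t, ∫ θ in (-Real.pi)..Real.pi, Real.exp (-2 * a * t) *
        (Real.exp (a * t) * (a * (a * φ (ε * t) + ε * φ₁ (ε * t)) +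
          ε * (a * φ₁ (ε * t) + ε * φ₂ (ε * t))) * Real.cos (k * θ) +
          Real.exp (a * t) * φ (ε * t) * (-(k ^ 2 * Real.cos (k * θ)))) ^ 2 =
        (∫ θ in (-Real.pi)..Real.pi, Real.cos (k * θ) ^ 2) *
          ((a ^ 2 - (k : ℝ) ^ 2) * φ (ε * t) + 2 * a * ε * φ₁ (ε * t) + ε ^ 2 * φ₂ (ε * t)) ^ 2 := by
      intro t
      have hexp : Real.exp (-2 * a * t) * Real.exp (a * t) ^ 2 = 1 := by
        rw [← Real.exp_nat_mul, ← Real.exp_add, Real.exp_eq_one_iff]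
        push_cast
        ring
      rw [← intervalIntegral.integral_mul_const]
      refine intervalIntegral.integral_congr fun θ _ => ?_
      linear_combination (Real.cos (k * θ) ^ 2 * ((a ^ 2 - (k : ℝ) ^ 2) * φ (ε * t) +
        2 * a * ε * φ₁ (ε * t) + ε ^ 2 * φ₂ (ε * t)) ^ 2) * hexp
    simp only [inner]
    rw [intervalIntegral.integral_const_mul, modeLapEnergy,
      intervalIntegral.integral_comp_mul_left
        (fun s => ((a ^ 2 - (k : ℝ) ^ 2) * φ s + 2 * a * ε * φ₁ s + ε ^ 2 * φ₂ s) ^ 2) hε.ne',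
      mul_neg, mul_div_cancel₀ _ hε.ne', smul_eq_mul]
    exact (mul_assoc _ _ _).symm
  · intro t θ
    simp only [modeTest_logPolar]
    exact hasDerivAt_exp_mul_comp_mul h₁ a ε _ t
  · intro t θ
    exact hasDerivAt_exp_mul_comp_mul (φ := fun s => a * φ s + ε * φ₁ s)
      (fun s => ((h₁ s).const_mul a).add ((h₂ s).const_mul ε)) a ε _ t
  · intro t θ
    simp only [modeTest_logPolar]
    convert! (((hasDerivAt_id θ).const_mul (k : ℝ)).cos).const_mul
      (Real.exp (a * t) * φ (ε * t)) using 1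
    simp only [id, mul_one]
    ring
  · intro t θ
    convert! ((((hasDerivAt_id θ).const_mul (k : ℝ)).sin.const_mul (k : ℝ)).neg).const_mul
      (Real.exp (a * t) * φ (ε * t)) using 1
    simp only [id, mul_one]
    ring

end ModeEnergy

theorem exists_logarithmic_cutoff : ∃ φ : ℝ → ℝ, ContDiff ℝ 2 φ ∧
    (∀ s, φ s ≠ 0 → 1 ≤ s ∧ s ≤ 3) ∧ 0 < ∫ s in (-4)..4, φ s ^ 2 := by
  let f : ContDiffBump (2 : ℝ) := ⟨1 / 2, 1, by norm_num, by norm_num⟩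
  refine ⟨f, f.contDiff, fun s hs => ?_, ?_⟩
  · have h : s ∈ Function.support f := hs
    rw [f.support_eq, Real.ball_eq_Ioo] at h
    have h₁ := h.1
    have h₂ := h.2
    simp only [f] at h₁ h₂
    constructor <;> linarith
  · have hf : Continuous f := f.continuous
    refine intervalIntegral.integral_pos (by norm_num) (by fun_prop) (fun s _ => sq_nonneg _)
      ⟨2, by norm_num, ?_⟩
    rw [f.one_of_mem_closedBall (Metric.mem_closedBall_self f.rIn_pos.le)]
    norm_num

theorem tendsto_mode_quotient {φ φ₁ φ₂ : ℝ → ℝ} (h₀ : Continuous φ) (h₁ : Continuous φ₁)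
    (h₂ : Continuous φ₂) (hpos : 0 < ∫ s in (-4)..4, φ s ^ 2) {a : ℝ} (ha : a ≠ 0) (k : ℕ) :
    (∀ᶠ ε in nhdsWithin 0 (Set.Ioi 0), modeGradientEnergy φ φ₁ a k ε ≠ 0) ∧
    Filter.Tendsto (fun ε => modeLapEnergy φ φ₁ φ₂ a k ε / modeGradientEnergy φ φ₁ a k ε)
      (nhdsWithin 0 (Set.Ioi 0))
      (nhds (((k : ℝ) ^ 2 - a ^ 2) ^ 2 / ((k : ℝ) ^ 2 + a ^ 2))) := by
  have hL : Continuous (modeLapEnergy φ φ₁ φ₂ a k) :=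
    intervalIntegral.continuous_parametric_intervalIntegral_of_continuous'
      (f := fun ε s => ((a ^ 2 - (k : ℝ) ^ 2) * φ s + 2 * a * ε * φ₁ s + ε ^ 2 * φ₂ s) ^ 2)
      (by simp only [Function.uncurry_def]; fun_prop) _ _
  have hG : Continuous (modeGradientEnergy φ φ₁ a k) :=
    intervalIntegral.continuous_parametric_intervalIntegral_of_continuous'
      (f := fun ε s => (a * φ s + ε * φ₁ s) ^ 2 + (k : ℝ) ^ 2 * φ s ^ 2)
      (by simp only [Function.uncurry_def]; fun_prop) _ _
  have hL₀ : modeLapEnergy φ φ₁ φ₂ a k 0 =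
      (∫ s in (-4)..4, φ s ^ 2) * ((k : ℝ) ^ 2 - a ^ 2) ^ 2 := by
    rw [modeLapEnergy, ← intervalIntegral.integral_mul_const]
    refine intervalIntegral.integral_congr fun s _ => ?_
    ring
  have hG₀ : modeGradientEnergy φ φ₁ a k 0 =
      (∫ s in (-4)..4, φ s ^ 2) * ((k : ℝ) ^ 2 + a ^ 2) := by
    rw [modeGradientEnergy, ← intervalIntegral.integral_mul_const]
    refine intervalIntegral.integral_congr fun s _ => ?_
    ring
  have hne : modeGradientEnergy φ φ₁ a k 0 ≠ 0 := by
    rw [hG₀]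
    positivity
  refine ⟨(hG.continuousAt.eventually_ne hne).filter_mono nhdsWithin_le_nhds, ?_⟩
  have h := (hL.continuousAt.div hG.continuousAt hne).tendsto (x := 0)
  rw [Pi.div_apply, hL₀, hG₀, mul_div_mul_left _ _ hpos.ne'] at h
  exact h.mono_left nhdsWithin_le_nhds

theorem statement10 (α : ℝ) (hα : α ≠ 2) :
    sInf {r : ℝ | ∃ u : EuclideanSpace ℝ (Fin 2) → ℝ,
        ContDiff ℝ 2 u ∧ HasCompactSupport u ∧
        (0 : EuclideanSpace ℝ (Fin 2)) ∉ tsupport u ∧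
        (∫ x : EuclideanSpace ℝ (Fin 2), ‖x‖ ^ (α - 2) * ‖gradient u x‖ ^ 2) ≠ 0 ∧
        r = (∫ x : EuclideanSpace ℝ (Fin 2), ‖x‖ ^ α * (lap u x) ^ 2) /
            (∫ x : EuclideanSpace ℝ (Fin 2), ‖x‖ ^ (α - 2) * ‖gradient u x‖ ^ 2)} =
      ⨅ k : ℕ, ((k : ℝ) ^ 2 - (α - 2) ^ 2 / 4) ^ 2 / ((k : ℝ) ^ 2 + (α - 2) ^ 2 / 4) := by
  obtain ⟨a, ha⟩ : ∃ a, -2 * a = α - 2 := ⟨-(α - 2) / 2, by ring⟩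
  have ha₀ : a ≠ 0 := by
    rintro rfl
    exact hα (by linarith)
  rw [show (α - 2) ^ 2 / 4 = a ^ 2 by rw [← ha]; ring]
  set S := {r : ℝ | ∃ u : EuclideanSpace ℝ (Fin 2) → ℝ,
        ContDiff ℝ 2 u ∧ HasCompactSupport u ∧
        (0 : EuclideanSpace ℝ (Fin 2)) ∉ tsupport u ∧
        (∫ x : EuclideanSpace ℝ (Fin 2), ‖x‖ ^ (α - 2) * ‖gradient u x‖ ^ 2) ≠ 0 ∧
        r = (∫ x : EuclideanSpace ℝ (Fin 2), ‖x‖ ^ α * (lap u x) ^ 2) /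
            (∫ x : EuclideanSpace ℝ (Fin 2), ‖x‖ ^ (α - 2) * ‖gradient u x‖ ^ 2)}
  obtain ⟨φ, hφ, hs, hpos⟩ := exists_logarithmic_cutoff
  have hφ₁ : ContDiff ℝ 1 (deriv φ) := ((contDiff_succ_iff_deriv (n := 1)).1 hφ).2.2
  have h₁ : ∀ s, HasDerivAt φ (deriv φ s) s := fun s =>
    (hφ.differentiable (by norm_num) s).hasDerivAt
  have h₂ : ∀ s, HasDerivAt (deriv φ) (deriv (deriv φ) s) s := fun s =>
    (hφ₁.differentiable (by norm_num) s).hasDerivAt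
  have hmem : ∀ k : ℕ, ∀ ε > 0, modeGradientEnergy φ (deriv φ) a k ε ≠ 0 →
      modeLapEnergy φ (deriv φ) (deriv (deriv φ)) a k ε /
        modeGradientEnergy φ (deriv φ) a k ε ∈ S := by
    intro k ε hε hne
    have hC := integral_cos_nat_mul_sq_pos k
    have hCε : (∫ θ in (-Real.pi)..Real.pi, Real.cos (k * θ) ^ 2) * ε⁻¹ ≠ 0 := by positivity
    refine ⟨modeTest φ a k ε, contDiff_modeTest hε hs hφ a k, hasCompactSupport_modeTest hε hs a k,
      zero_notMem_tsupport_modeTest hε hs a k, ?_, ?_⟩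
    · rw [integral_gradient_modeTest h₁ hε hs hφ ha]
      exact mul_ne_zero hCε hne
    · rw [integral_gradient_modeTest h₁ hε hs hφ ha,
        integral_lap_modeTest h₁ h₂ hε hs hφ ha, mul_div_mul_left _ _ hCε]
  have hlim := fun k : ℕ => tendsto_mode_quotient (a := a) hφ.continuous hφ₁.continuous
    (hφ₁.continuous_deriv (by norm_num)) hpos ha₀ k
  have hbdd : BddBelow S := by
    refine ⟨0, ?_⟩
    rintro r ⟨u, -, -, -, -, rfl⟩
    exact div_nonneg (integral_nonneg fun x => by positivity)
      (integral_nonneg fun x => by positivity)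
  have hbdd' : BddBelow (Set.range fun k : ℕ =>
      ((k : ℝ) ^ 2 - a ^ 2) ^ 2 / ((k : ℝ) ^ 2 + a ^ 2)) := by
    refine ⟨0, ?_⟩
    rintro _ ⟨k, rfl⟩
    positivity
  apply le_antisymm
  · refine le_ciInf fun k => ge_of_tendsto (hlim k).2 ?_
    filter_upwards [(hlim k).1, self_mem_nhdsWithin] with ε hne hε
    exact csInf_le hbdd (hmem k ε hε hne)
  · have hne : S.Nonempty := by
      obtain ⟨ε, h, hε⟩ := ((hlim 0).1.and self_mem_nhdsWithin).exists
      exact ⟨_, hmem 0 ε hε h⟩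
    refine le_csInf hne ?_
    rintro r ⟨u, hu, hcs, h0, hD, rfl⟩
    obtain ⟨T, hT, hsupp⟩ := exists_annulus_of_tsupport hcs h0
    rw [le_div_iff₀ (lt_of_le_of_ne (integral_nonneg fun x => by positivity) hD.symm)]
    refine integral_gradient_le_integral_lap hu ha ha₀ hT hsupp fun k => ?_
    have h := ciInf_le hbdd' k.natAbs
    have hk : ((k.natAbs : ℕ) : ℝ) ^ 2 = (k : ℝ) ^ 2 := by
      rw [Nat.cast_natAbs, Int.cast_abs, sq_abs]
    rw [hk] at h
    rwa [← le_div_iff₀ (by positivity)]
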